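/- For a degree-1 homogeneous differentiable function, one-sided relative smoothness is equivalent to symmetric relative smoothness: let f be differentiable on an open convex set C with ⟨x, ∇f(x)⟩ = f(x) for all x (Euler homogeneity of degree 1), and φ be differentiable and strictly convex. Then Lφ − f is convex on C if and only if ⟨x, ∇f(x) − ∇f(y)⟩ ≤ L·D_φ(x, y) for all x, y ∈ C. -/

import Mathlib

open scoped RealInnerProductSpace

/-- A convex function lies above its tangent hyperplanes. -/
theorem ConvexOn.add_fderiv_sub_le {E : Type*} [NormedAddCommGroup E] [NormedSpace ℝ E]
    {C : Set E} {g : E → ℝ} (hg : ConvexOn ℝ C g) {g' : E →L[ℝ] ℝ} {x y : E}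
    (hx : x ∈ C) (hy : y ∈ C) (hd : HasFDerivAt g g' y) :
    g y + g' (x - y) ≤ g x := by
  have hc := hg.comp_affineMap (AffineMap.lineMap y x)
  have hl : HasDerivAt (AffineMap.lineMap y x : ℝ → E) (x - y) 0 :=
    AffineMap.hasDerivAt_lineMap
  have hd' : HasDerivAt (g ∘ (AffineMap.lineMap y x : ℝ → E)) (g' (x - y)) 0 :=
    HasFDerivAt.comp_hasDerivAt (x := (0 : ℝ)) (by simpa using hd) hl
  have h := hc.le_slope_of_hasDerivAt (x := 0) (y := 1) (by simpa using hy) (by simpa using hx)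
    zero_lt_one hd'
  simp only [slope_def_field, Function.comp_apply, AffineMap.lineMap_apply_one,
    AffineMap.lineMap_apply_zero, sub_zero, div_one] at h
  linarith

/-- A function lying above an affine minorant touching it at each point of a convex set is
convex there. -/
theorem convexOn_of_add_apply_sub_le {E : Type*} [AddCommGroup E] [Module ℝ E]
    {C : Set E} (hC : Convex ℝ C) {g : E → ℝ} (g' : E → E →ₗ[ℝ] ℝ)
    (h : ∀ x ∈ C, ∀ y ∈ C, g y + g' y (x - y) ≤ g x) : ConvexOn ℝ C g := by
  refine ⟨hC, fun x hx y hy a b ha hb hab => ?_⟩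
  have hz := hC hx hy ha hb hab
  have h₁ := mul_le_mul_of_nonneg_left (h x hx _ hz) ha
  have h₂ := mul_le_mul_of_nonneg_left (h y hy _ hz) hb
  obtain rfl : b = 1 - a := by linarith
  simp only [map_sub, map_add, map_smul, smul_eq_mul] at h₁ h₂ ⊢
  linarith

/-- For a degree-1 (Euler) homogeneous differentiable function `f` on an open convex set
`C`, with `φ` differentiable and strictly convex, `Lφ − f` is convex on `C` iff
`⟨x, ∇f(x) − ∇f(y)⟩ ≤ L·D_φ(x, y)` for all `x, y ∈ C`. -/
theorem stmt_18 {V : Type*} [NormedAddCommGroup V] [InnerProductSpace ℝ V]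
    [FiniteDimensional ℝ V]
    (C : Set V) (hC : Convex ℝ C) (hCo : IsOpen C) (f φ : V → ℝ)
    (hf : DifferentiableOn ℝ f C)
    (heuler : ∀ x ∈ C, ⟪x, gradient f x⟫ = f x)
    (hφ : Differentiable ℝ φ) (hφsc : StrictConvexOn ℝ C φ) (L : ℝ) :
    ConvexOn ℝ C (fun x => L * φ x - f x) ↔
      ∀ x ∈ C, ∀ y ∈ C,
        ⟪x, gradient f x - gradient f y⟫ ≤
          L * (φ x - φ y - ⟪gradient φ y, x - y⟫) := by
  have key : ∀ x ∈ C, ∀ y ∈ C, (⟪x, gradient f x - gradient f y⟫ ≤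
        L * (φ x - φ y - ⟪gradient φ y, x - y⟫) ↔
      (L * φ y - f y) + (L • fderiv ℝ φ y - fderiv ℝ f y) (x - y) ≤ L * φ x - f x) := by
    intro x hx y hy
    have hfy : ⟪y, gradient f y⟫ = fderiv ℝ f y y := by
      rw [real_inner_comm, gradient, InnerProductSpace.toDual_symm_apply]
    have hfx : ⟪x, gradient f y⟫ = fderiv ℝ f y x := by
      rw [real_inner_comm, gradient, InnerProductSpace.toDual_symm_apply]
    have hφy : ⟪gradient φ y, x - y⟫ = fderiv ℝ φ y (x - y) := by
      rw [gradient, InnerProductSpace.toDual_symm_apply]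
    have hy' := heuler y hy
    rw [inner_sub_right, heuler x hx, hfx, hφy, sub_apply,
      smul_apply, smul_eq_mul, map_sub (fderiv ℝ f y)]
    constructor <;> intro h <;> linarith
  constructor
  · intro h x hx y hy
    exact (key x hx y hy).2 <| h.add_fderiv_sub_le hx hy <|
      ((hφ y).hasFDerivAt.const_mul L).sub
        (hf.differentiableAt (hCo.mem_nhds hy)).hasFDerivAt
  · intro h
    exact convexOn_of_add_apply_sub_le hC
      (fun y => (L • fderiv ℝ φ y - fderiv ℝ f y : V →L[ℝ] ℝ).toLinearMap)
      fun x hx y hy => (key x hx y hy).1 (h x hx y hy)
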